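/- Let A be an abelian category, B a Serre subcategory, π : A → A/B the quotient, and D a thick subcategory of A containing B. For every n ≥ 0 and every object E of A, if π(E) lies in th^n(π(D)) (the n-th step of the thick filtration in A/B generated by the image of D), then E lies in D. -/

import Mathlib

open CategoryTheory CategoryTheory.Limits

universe v u v' u'

variable {C : Type u} [Category.{v} C] [Abelian C]

/-- `X` is a retract (direct summand) of `B`. -/
def IsRetract {E : Type*} [Category E] (X B : E) : Prop :=
  ∃ (s : X ⟶ B) (r : B ⟶ X), s ≫ r = 𝟙 X

section Defs

variable {A : Type u'} [Category.{v'} A] [Abelian A]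

/-- A thick subcategory of an abelian category, given by its set of objects:
strictly full, additive, closed under direct summands, and with the
two-out-of-three property for short exact sequences. -/
structure IsThickAb (T : Set A) : Prop where
  mem_of_iso : ∀ {X Y : A}, (X ≅ Y) → X ∈ T → Y ∈ T
  zero_mem : ∀ {X : A}, IsZero X → X ∈ T
  retract_mem : ∀ {X B : A}, IsRetract X B → B ∈ T → X ∈ T
  mem₂ : ∀ (S : ShortComplex A), S.ShortExact → S.X₁ ∈ T → S.X₃ ∈ T → S.X₂ ∈ T
  mem₁ : ∀ (S : ShortComplex A), S.ShortExact → S.X₂ ∈ T → S.X₃ ∈ T → S.X₁ ∈ T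
  mem₃ : ∀ (S : ShortComplex A), S.ShortExact → S.X₁ ∈ T → S.X₂ ∈ T → S.X₃ ∈ T

/-- The smallest thick subcategory of an abelian category containing `S`. -/
def thickClosure (S : Set A) : Set A :=
  {X | ∀ T : Set A, IsThickAb T → S ⊆ T → X ∈ T}

/-- A Serre subcategory of an abelian category, given by its set of objects:
a nonempty full subcategory closed under subobjects, quotients and extensions. -/
structure IsSerre (B : Set A) : Prop where
  nonempty : B.Nonempty
  subobject_mem : ∀ {X Y : A} (f : X ⟶ Y), Mono f → Y ∈ B → X ∈ B
  quotient_mem : ∀ {X Y : A} (f : X ⟶ Y), Epi f → X ∈ B → Y ∈ B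
  extension_mem : ∀ (S : ShortComplex A), S.ShortExact → S.X₁ ∈ B → S.X₃ ∈ B → S.X₂ ∈ B

/-- The class of morphisms whose kernel and cokernel both lie in `B`.  The Serre
quotient `A ⥤ A/B` is precisely the localization of `A` at this class of morphisms,
so a functor `π : A ⥤ D` is (equivalent to) the Serre quotient functor if and only if
it is a localization functor with respect to `serreW B`. -/
def serreW (B : Set A) : MorphismProperty A :=
  fun _ _ f => Limits.kernel f ∈ B ∧ Limits.cokernel f ∈ B

/-- The image of a set of objects under a functor, up to isomorphism. -/
def imageSet {A' : Type*} [Category A'] (π : A ⥤ A') (T : Set A) : Set A' :=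
  {Y | ∃ X ∈ T, Nonempty (π.obj X ≅ Y)}

end Defs

variable {D : Type u'} [Category.{v'} D] [Abelian D]


section Filtration

variable {A : Type u'} [Category.{v'} A] [Abelian A]

instance (priority := 100) : HasFiniteBiproducts A :=
  HasFiniteBiproducts.of_hasFiniteProducts

/-- `add S`: direct summands of finite coproducts of objects of `S`. -/
def addHull (S : Set A) : Set A :=
  {X | ∃ (n : ℕ) (f : Fin n → A), (∀ i, f i ∈ S) ∧ IsRetract X (⨁ f)}

/-- The filtration `th^n(S)` of the thick closure of `S` in an abelian category. -/
def thStep (S : Set A) : ℕ → Set A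
  | 0 => {X | IsZero X}
  | 1 => addHull S
  | n + 2 => {X | ∃ SC : ShortComplex A, SC.ShortExact ∧
      ((IsRetract X SC.X₁ ∧ SC.X₂ ∈ thStep S (n + 1) ∧ SC.X₃ ∈ thStep S (n + 1)) ∨
       (IsRetract X SC.X₂ ∧ SC.X₁ ∈ thStep S (n + 1) ∧ SC.X₃ ∈ thStep S (n + 1)) ∨
       (IsRetract X SC.X₃ ∧ SC.X₁ ∈ thStep S (n + 1) ∧ SC.X₂ ∈ thStep S (n + 1)))}

end Filtration

section Helpers

open ObjectProperty SerreClassLocalization ZeroObject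

/-- A Serre subcategory in the sense of `IsSerre` is a Serre class in the sense of Mathlib. -/
lemma IsSerre.isSerreClass {B : Set C} (hB : IsSerre B) :
    ObjectProperty.IsSerreClass (C := C) (fun X => X ∈ B) where
  exists_zero := by
    obtain ⟨X, hX⟩ := hB.nonempty
    exact ⟨_, isZero_zero C, hB.subobject_mem (0 : (0 : C) ⟶ X) inferInstance hX⟩
  prop_of_mono f hf hY := hB.subobject_mem f hf hY
  prop_of_epi f hf hY := hB.quotient_mem f hf hY
  prop_X₂_of_shortExact hS h₁ h₃ := hB.extension_mem _ hS h₁ h₃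

/-- The quotient functor is exact. -/
lemma serreQuotient_exact {D' : Type*} [Category D'] (P : ObjectProperty C) [P.IsSerreClass]
    (π : C ⥤ D') [π.IsLocalization P.isoModSerre] :
    PreservesFiniteLimits π ∧ PreservesFiniteColimits π := by
  let := Localization.preadditive π P.isoModSerre
  have := Localization.functor_additive π P.isoModSerre
  exact ⟨preservesFiniteLimits π P, preservesFiniteColimits π P⟩

lemma serreQuotient_additive (P : ObjectProperty C) [P.IsSerreClass]
    (π : C ⥤ D) [π.IsLocalization P.isoModSerre] : π.Additive := by
  obtain ⟨_, _⟩ := serreQuotient_exact P π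
  exact Functor.additive_of_preserves_binary_products π

lemma IsThickAb.biproduct_mem {T : Set D} (hT : IsThickAb T) (n : ℕ) (f : Fin n → D)
    (hf : ∀ i, f i ∈ T) : (⨁ f) ∈ T := by
  induction n with
  | zero =>
    apply hT.zero_mem
    rw [IsZero.iff_id_eq_zero]
    ext i
    exact i.elim0
  | succ n ih =>
    have h := ih (fun i => f i.succ) (fun i => hf _)
    have h2 : (f 0 ⊞ (⨁ fun i : Fin n => f i.succ)) ∈ T :=
      hT.mem₂ _ (ShortComplex.Splitting.ofHasBinaryBiproduct _ _).shortExact (hf 0) h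
    refine hT.retract_mem ⟨biprod.lift (biproduct.π f 0)
      (biproduct.lift fun i : Fin n => biproduct.π f i.succ),
      biprod.desc (biproduct.ι f 0) (biproduct.desc fun i : Fin n => biproduct.ι f i.succ), ?_⟩ h2
    rw [biprod.lift_desc, biproduct.lift_desc, ← biproduct.total, Fin.sum_univ_succ]

lemma IsThickAb.thStep_subset {T S : Set D} (hT : IsThickAb T) (hS : S ⊆ T) (n : ℕ) :
    ∀ X ∈ thStep S n, X ∈ T := by
  induction n with
  | zero => exact fun X hX => hT.zero_mem hX
  | succ n ih =>
    cases n with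
    | zero =>
      rintro X ⟨n, f, hf, hX⟩
      exact hT.retract_mem hX (hT.biproduct_mem n f fun i => hS (hf i))
    | succ n =>
      rintro X ⟨SC, hSC, ⟨hX, h, h'⟩ | ⟨hX, h, h'⟩ | ⟨hX, h, h'⟩⟩
      · exact hT.retract_mem hX (hT.mem₁ _ hSC (ih _ h) (ih _ h'))
      · exact hT.retract_mem hX (hT.mem₂ _ hSC (ih _ h) (ih _ h'))
      · exact hT.retract_mem hX (hT.mem₃ _ hSC (ih _ h) (ih _ h'))

lemma IsThickAb.mem_iff_of_isoModSerre {T : Set C} (hT : IsThickAb T) (P : ObjectProperty C)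
    [P.IsSerreClass] (hP : ∀ X, P X → X ∈ T) {X Y : C} (f : X ⟶ Y) (hf : P.isoModSerre f) :
    X ∈ T ↔ Y ∈ T := by
  have h₁ : (ShortComplex.mk (kernel.ι f) (Abelian.factorThruImage f) (by
      rw [← cancel_mono (Abelian.image.ι f)]; simp)).ShortExact :=
    { exact := ShortComplex.exact_of_f_is_kernel _
        (isKernelOfComp (Abelian.image.ι f) f (kernelIsKernel f) _ (by simp)) }
  have h₂ : (ShortComplex.mk (Abelian.image.ι f) (cokernel.π f) (by
      exact kernel.condition _)).ShortExact :=
    { exact := ShortComplex.exact_of_f_is_kernel _ (kernelIsKernel (cokernel.π f)) }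
  have hk := hP _ hf.1
  have hc := hP _ hf.2
  exact ⟨fun h => hT.mem₂ _ h₂ (hT.mem₃ _ h₁ hk h) hc,
    fun h => hT.mem₂ _ h₁ hk (hT.mem₁ _ h₂ h hc)⟩

lemma IsThickAb.mem_of_iso_map {T : Set C} (hT : IsThickAb T) (P : ObjectProperty C)
    [P.IsSerreClass] (hP : ∀ X, P X → X ∈ T)
    (π : C ⥤ D) [π.IsLocalization P.isoModSerre] {X Y : C} (e : π.obj X ≅ π.obj Y)
    (hX : X ∈ T) : Y ∈ T := by
  have := serreQuotient_additive P π
  obtain ⟨φ, hφ⟩ := Localization.exists_rightFraction π P.isoModSerre e.hom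
  have h : π.map φ.s ≫ e.hom = π.map φ.f := by
    rw [hφ, MorphismProperty.RightFraction.map_s_comp_map]
  have := Localization.inverts π P.isoModSerre φ.s φ.hs
  have h' : IsIso (π.map φ.f) := by rw [← h]; infer_instance
  rw [isIso_map_iff π P] at h'
  exact (hT.mem_iff_of_isoModSerre P hP _ h').1 ((hT.mem_iff_of_isoModSerre P hP _ φ.hs).2 hX)

lemma exists_lift_shortExact (P : ObjectProperty C) [P.IsSerreClass]
    (π : C ⥤ D) [π.IsLocalization P.isoModSerre] (S : ShortComplex D) (hS : S.ShortExact) :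
    ∃ S' : ShortComplex C, S'.ShortExact ∧ Nonempty (π.obj S'.X₁ ≅ S.X₁) ∧
      Nonempty (π.obj S'.X₂ ≅ S.X₂) ∧ Nonempty (π.obj S'.X₃ ≅ S.X₃) := by
  have := serreQuotient_additive P π
  obtain ⟨_, _⟩ := serreQuotient_exact P π
  obtain ⟨X, Y, f, _, ⟨e⟩⟩ := (mono_iff π P S.f).1 hS.mono_f
  have e₁ : π.obj X ≅ S.X₁ := Arrow.leftFunc.mapIso e
  have e₂ : π.obj Y ≅ S.X₂ := Arrow.rightFunc.mapIso e
  have e₃ : cokernel (π.map f) ≅ cokernel S.f :=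
    cokernel.mapIso _ _ (Arrow.leftFunc.mapIso e) (Arrow.rightFunc.mapIso e) e.hom.w.symm
  refine ⟨ShortComplex.mk f (cokernel.π f) (by simp), ?_, ⟨e₁⟩, ⟨e₂⟩, ⟨?_⟩⟩
  · exact { exact := ShortComplex.exact_of_g_is_cokernel _ (cokernelIsCokernel f) }
  · exact PreservesCokernel.iso π f ≪≫ e₃ ≪≫
      (cokernelIsCokernel S.f).coconePointUniqueUpToIso hS.gIsCokernel

lemma IsThickAb.imageSet {T : Set C} (hT : IsThickAb T) (P : ObjectProperty C)
    [P.IsSerreClass] (hP : ∀ X, P X → X ∈ T)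
    (π : C ⥤ D) [π.IsLocalization P.isoModSerre] : IsThickAb (imageSet π T) := by
  have := serreQuotient_additive P π
  have := Localization.essSurj π P.isoModSerre
  have key : ∀ {X : C} {Y : D}, Nonempty (π.obj X ≅ Y) → Y ∈ _root_.imageSet π T → X ∈ T := by
    rintro X Y ⟨e⟩ ⟨X', hX', ⟨e'⟩⟩
    exact hT.mem_of_iso_map P hP π (e' ≪≫ e.symm) hX'
  refine ⟨?_, ?_, ?_, ?_, ?_, ?_⟩
  · rintro X Y e ⟨Z, hZ, ⟨e'⟩⟩
    exact ⟨Z, hZ, ⟨e' ≪≫ e⟩⟩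
  · intro X hX
    exact ⟨0, hT.zero_mem (isZero_zero C), ⟨(π.map_isZero (isZero_zero C)).iso hX⟩⟩
  · rintro X Y ⟨s, r, hsr⟩ ⟨F, hF, ⟨e⟩⟩
    have : Mono s := mono_of_mono_fac hsr
    let sp := ShortComplex.Splitting.ofExactOfRetraction
      (ShortComplex.mk s (cokernel.π s) (by simp))
      (ShortComplex.exact_of_g_is_cokernel _ (cokernelIsCokernel s)) r hsr inferInstance
    let E := π.objPreimage X
    let G := π.objPreimage (cokernel s)
    have e' : Y ≅ X ⊞ cokernel s := sp.isoBinaryBiproduct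
    have := preservesBinaryBiproducts_of_preservesBiproducts π
    have eSum : π.obj (E ⊞ G) ≅ X ⊞ cokernel s :=
      π.mapBiprod E G ≪≫ biprod.mapIso (π.objObjPreimageIso X) (π.objObjPreimageIso _)
    have h : (E ⊞ G) ∈ T := hT.mem_of_iso_map P hP π (e ≪≫ e' ≪≫ eSum.symm) hF
    exact ⟨E, hT.retract_mem ⟨biprod.inl, biprod.fst, by simp⟩ h, ⟨π.objObjPreimageIso X⟩⟩
  all_goals
    intro S hS h h'
    obtain ⟨S', hS', e₁, e₂, e₃⟩ := exists_lift_shortExact P π S hS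
  · exact ⟨_, hT.mem₂ _ hS' (key e₁ h) (key e₃ h'), e₂⟩
  · exact ⟨_, hT.mem₁ _ hS' (key e₂ h) (key e₃ h'), e₁⟩
  · exact ⟨_, hT.mem₃ _ hS' (key e₁ h) (key e₂ h'), e₃⟩

end Helpers

/-- Let `B` be a Serre subcategory of `C`, `π : C ⥤ D` the quotient functor, and `T` a
thick subcategory of `C` containing `B`.  For every `n ≥ 0` and every object `E` of `C`,
if `π(E)` lies in `th^n(π(T))`, the `n`-th step of the thick filtration in `D = C/B`
generated by the image of `T`, then `E` lies in `T`. -/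
theorem mem_of_image_mem_thStep (B : Set C) (hB : IsSerre B)
    (π : C ⥤ D) [π.IsLocalization (serreW B)]
    (T : Set C) (hT : IsThickAb T) (hBT : B ⊆ T)
    (n : ℕ) (E : C) (hE : π.obj E ∈ thStep (imageSet π T) n) : E ∈ T := by
  have : ObjectProperty.IsSerreClass (C := C) (fun X => X ∈ B) := hB.isSerreClass
  let P : ObjectProperty C := fun X => X ∈ B
  have : π.IsLocalization P.isoModSerre := ‹π.IsLocalization (serreW B)›
  have hP : ∀ X, P X → X ∈ T := fun X hX => hBT hX
  obtain ⟨X, hX, ⟨e⟩⟩ := (hT.imageSet P hP π).thStep_subset le_rfl n _ hE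
  exact hT.mem_of_iso_map P hP π e hX
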